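/- If limsup_{n→∞} (M̄_n)^{1/n} ≤ 12.901, then limsup_{n→∞} (M_n)^{1/n} ≤ √12.901. -/

import Mathlib

open Filter

/-- `x` lies strictly between `p` and `q`. -/
def StrictlyBetween (p q x : ℕ) : Prop := min p q < x ∧ x < max p q

/-- Two arcs `{p, q}` and `{r, s}` cross if exactly one of `r`, `s` lies strictly
between `p` and `q`. -/
def ArcsCross (p q r s : ℕ) : Prop :=
  Xor' (StrictlyBetween p q r) (StrictlyBetween p q s)

/-- `a` (with one-based indexing, only the values `a 1, …, a n` being relevant)
is an open meandric permutation of order `n`: it is a permutation of `{1, …, n}`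
with `a i ≡ i (mod 2)`, whose upper arcs (pairs `{a i, a (i+1)}` for odd `i < n`)
are pairwise noncrossing, whose lower arcs (pairs `{a i, a (i+1)}` for even
`1 ≤ i < n`) are pairwise noncrossing, such that no lower arc strictly encloses
`a 1`, and no lower arc (if `n` is even) resp. upper arc (if `n` is odd)
strictly encloses `a n`. -/
def IsOpenMeandricPerm (n : ℕ) (a : ℕ → ℕ) : Prop :=
  1 ≤ n ∧
  (∀ i, 1 ≤ i → i ≤ n → 1 ≤ a i ∧ a i ≤ n) ∧
  (∀ i j, 1 ≤ i → i ≤ n → 1 ≤ j → j ≤ n → a i = a j → i = j) ∧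
  (∀ i, 1 ≤ i → i ≤ n → a i % 2 = i % 2) ∧
  (∀ i j, Odd i → i < n → Odd j → j < n →
      ¬ ArcsCross (a i) (a (i + 1)) (a j) (a (j + 1))) ∧
  (∀ i j, Even i → 1 ≤ i → i < n → Even j → 1 ≤ j → j < n →
      ¬ ArcsCross (a i) (a (i + 1)) (a j) (a (j + 1))) ∧
  (∀ i, Even i → 1 ≤ i → i < n → ¬ StrictlyBetween (a i) (a (i + 1)) (a 1)) ∧
  (if Even n
    then ∀ i, Even i → 1 ≤ i → i < n → ¬ StrictlyBetween (a i) (a (i + 1)) (a n)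
    else ∀ i, Odd i → i < n → ¬ StrictlyBetween (a i) (a (i + 1)) (a n))

/-- An open meandric permutation of order `n` is irreducible if there are no
indices `1 ≤ k₁ < k₂ ≤ n` with `2 < k₂ - k₁ ≤ n - 2` such that the values
`a k₁, …, a k₂` form an interval of integers, i.e. their max minus their min
equals `k₂ - k₁`. -/
def IsIrreducibleMeander (n : ℕ) (a : ℕ → ℕ) : Prop :=
  ¬ ∃ k₁ k₂ : ℕ, ∃ h : k₁ < k₂, 1 ≤ k₁ ∧ k₂ ≤ n ∧ 2 < k₂ - k₁ ∧ k₂ - k₁ ≤ n - 2 ∧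
    (Finset.Icc k₁ k₂).sup' (Finset.nonempty_Icc.mpr h.le) a -
      (Finset.Icc k₁ k₂).inf' (Finset.nonempty_Icc.mpr h.le) a = k₂ - k₁

/-- An open meandric permutation of order `n` is prime if `a 1 ≠ 1` and no proper
initial segment `a 1, …, a j` (`2 ≤ j < n`) is a permutation of `{1, …, j}`. -/
def IsPrimeMeander (n : ℕ) (a : ℕ → ℕ) : Prop :=
  a 1 ≠ 1 ∧ ¬ ∃ j, 2 ≤ j ∧ j < n ∧ (Finset.Icc 1 j).image a = Finset.Icc 1 j

/-- `a` (with one-based indexing) is a closed meandric permutation of order `n`: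
a permutation of `{1, …, 2n}` with `a 1 = 1`, `a i ≡ i (mod 2)`, pairwise
noncrossing upper arcs `{a i, a (i+1)}` (odd `i < 2n`) and pairwise noncrossing
lower arcs, the latter being the `{a i, a (i+1)}` for even `1 ≤ i < 2n` together
with the wrap-around arc `{a (2n), a 1}`. -/
def IsClosedMeandricPerm (n : ℕ) (a : ℕ → ℕ) : Prop :=
  1 ≤ n ∧ a 1 = 1 ∧
  (∀ i, 1 ≤ i → i ≤ 2 * n → 1 ≤ a i ∧ a i ≤ 2 * n) ∧
  (∀ i j, 1 ≤ i → i ≤ 2 * n → 1 ≤ j → j ≤ 2 * n → a i = a j → i = j) ∧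
  (∀ i, 1 ≤ i → i ≤ 2 * n → a i % 2 = i % 2) ∧
  (∀ i j, Odd i → i < 2 * n → Odd j → j < 2 * n →
      ¬ ArcsCross (a i) (a (i + 1)) (a j) (a (j + 1))) ∧
  (∀ i j, Even i → 1 ≤ i → i < 2 * n → Even j → 1 ≤ j → j < 2 * n →
      ¬ ArcsCross (a i) (a (i + 1)) (a j) (a (j + 1))) ∧
  (∀ i, Even i → 1 ≤ i → i < 2 * n →
      ¬ ArcsCross (a i) (a (i + 1)) (a (2 * n)) (a 1) ∧
      ¬ ArcsCross (a (2 * n)) (a 1) (a i) (a (i + 1)))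

/-- `M n`: the number of open meandric permutations of order `n` (each counted
once via the normalization `a i = 0` outside `{1, …, n}`). -/
noncomputable def openMeanderCount (n : ℕ) : ℕ :=
  Set.ncard {a : ℕ → ℕ | IsOpenMeandricPerm n a ∧ ∀ i, i < 1 ∨ n < i → a i = 0}

/-- `M^{Irr} n`: the number of irreducible open meandric permutations of order `n`. -/
noncomputable def irrMeanderCount (n : ℕ) : ℕ :=
  Set.ncard {a : ℕ → ℕ | IsOpenMeandricPerm n a ∧ IsIrreducibleMeander n a ∧
    ∀ i, i < 1 ∨ n < i → a i = 0}

/-- `M^{(P)} n`: the number of prime open meandric permutations of order `n`. -/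
noncomputable def primeMeanderCount (n : ℕ) : ℕ :=
  Set.ncard {a : ℕ → ℕ | IsOpenMeandricPerm n a ∧ IsPrimeMeander n a ∧
    ∀ i, i < 1 ∨ n < i → a i = 0}

/-- `M̄ n`: the number of closed meandric permutations of order `n`. -/
noncomputable def closedMeanderCount (n : ℕ) : ℕ :=
  Set.ncard {a : ℕ → ℕ | IsClosedMeandricPerm n a ∧ ∀ i, i < 1 ∨ 2 * n < i → a i = 0}

/-! ### Cyclic meanders -/

theorem arcsCross_iff {p q r s : ℕ} : ArcsCross p q r s ↔
    StrictlyBetween p q r ∧ ¬ StrictlyBetween p q s ∨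
      StrictlyBetween p q s ∧ ¬ StrictlyBetween p q r :=
  Iff.rfl

/-- A closed meander of order `k` without a marked starting point, traversed periodically:
`B i` is the position of the crossing visited at (zero-based) time `i`. -/
structure IsCyclicMeander (k : ℕ) (B : ℕ → ℕ) : Prop where
  pos : 1 ≤ k
  periodic : Function.Periodic B (2 * k)
  mem_range : ∀ i, 1 ≤ B i ∧ B i ≤ 2 * k
  inj : ∀ i j, B i = B j → i ≡ j [MOD 2 * k]
  parity : ∀ i, B i % 2 = (i + 1) % 2
  noncrossing : ∀ i j, i % 2 = j % 2 → ¬ ArcsCross (B i) (B (i + 1)) (B j) (B (j + 1))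

/-- Changing the starting point of a cyclic meander by an even amount. -/
theorem IsCyclicMeander.shift {k : ℕ} {B : ℕ → ℕ} (hB : IsCyclicMeander k B) {p : ℕ}
    (hp : p % 2 = 0) : IsCyclicMeander k (fun i => B (i + p)) where
  pos := hB.pos
  periodic i := by
    have := hB.periodic (i + p)
    rwa [add_right_comm] at this
  mem_range i := hB.mem_range _
  inj i j h := Nat.ModEq.add_right_cancel' p (hB.inj _ _ h)
  parity i := by
    have := hB.parity (i + p)
    omega
  noncrossing i j h := by
    have := hB.noncrossing (i + p) (j + p) (by omega)
    rwa [add_right_comm i, add_right_comm j] at this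

/-- Every position is visited within one period. -/
theorem IsCyclicMeander.exists_eq {k : ℕ} {B : ℕ → ℕ} (hB : IsCyclicMeander k B) {x : ℕ}
    (h1 : 1 ≤ x) (h2 : x ≤ 2 * k) : ∃ p < 2 * k, B p = x := by
  have hinj : Set.InjOn B (Finset.range (2 * k)) := by
    intro i hi j hj h
    simp only [Finset.coe_range, Set.mem_Iio] at hi hj
    exact Nat.ModEq.eq_of_lt_of_lt (hB.inj i j h) hi hj
  have hsub : (Finset.range (2 * k)).image B ⊆ Finset.Icc 1 (2 * k) := by
    intro y hy
    obtain ⟨i, -, rfl⟩ := Finset.mem_image.1 hy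
    exact Finset.mem_Icc.2 (hB.mem_range i)
  have heq := Finset.eq_of_subset_of_card_le hsub (by simp [Finset.card_image_of_injOn hinj])
  have hx : x ∈ (Finset.range (2 * k)).image B := heq ▸ Finset.mem_Icc.2 ⟨h1, h2⟩
  obtain ⟨p, hp, rfl⟩ := Finset.mem_image.1 hx
  exact ⟨p, Finset.mem_range.1 hp, rfl⟩

theorem not_arcsCross_self (p q : ℕ) : ¬ ArcsCross p q p q := by
  simp only [arcsCross_iff, StrictlyBetween]
  omega

/-- The periodic extension of a permutation all of whose arcs, including the closing one,
are noncrossing. -/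
theorem isCyclicMeander_mod {k : ℕ} {b : ℕ → ℕ} (hk : 1 ≤ k)
    (hr : ∀ i, 1 ≤ i → i ≤ 2 * k → 1 ≤ b i ∧ b i ≤ 2 * k)
    (hi : ∀ i j, 1 ≤ i → i ≤ 2 * k → 1 ≤ j → j ≤ 2 * k → b i = b j → i = j)
    (hp : ∀ i, 1 ≤ i → i ≤ 2 * k → b i % 2 = i % 2)
    (hu : ∀ i j, Odd i → i < 2 * k → Odd j → j < 2 * k →
      ¬ ArcsCross (b i) (b (i + 1)) (b j) (b (j + 1)))
    (hl : ∀ i j, Even i → 1 ≤ i → i < 2 * k → Even j → 1 ≤ j → j < 2 * k →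
      ¬ ArcsCross (b i) (b (i + 1)) (b j) (b (j + 1)))
    (hw : ∀ i, Even i → 1 ≤ i → i < 2 * k →
      ¬ ArcsCross (b i) (b (i + 1)) (b (2 * k)) (b 1) ∧
      ¬ ArcsCross (b (2 * k)) (b 1) (b i) (b (i + 1))) :
    IsCyclicMeander k (fun i => b (i % (2 * k) + 1)) where
  pos := hk
  periodic i := by simp
  mem_range i := hr _ (by omega) (Nat.mod_lt _ (by omega))
  inj i j h := by
    have := hi _ _ (by omega) (Nat.mod_lt i (by omega)) (by omega) (Nat.mod_lt j (by omega)) h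
    simpa [Nat.ModEq] using this
  parity i := by
    have h1 := hp (i % (2 * k) + 1) (by omega) (Nat.mod_lt i (by omega))
    have h2 : i % (2 * k) % 2 = i % 2 := Nat.mod_mul_right_mod i 2 k
    omega
  noncrossing i j hij := by
    have hi2 : i % (2 * k) % 2 = i % 2 := Nat.mod_mul_right_mod i 2 k
    have hj2 : j % (2 * k) % 2 = j % 2 := Nat.mod_mul_right_mod j 2 k
    have hsucc : ∀ i, (i + 1) % (2 * k) = if i % (2 * k) + 1 = 2 * k then 0
        else i % (2 * k) + 1 := by
      intro i
      have := Nat.mod_lt i (show 2 * k > 0 by omega)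
      split_ifs with h
      · rw [Nat.add_mod_eq_ite, Nat.mod_eq_of_lt (show 1 < 2 * k by omega)]
        simp [h]
      · rw [Nat.add_mod_eq_ite, Nat.mod_eq_of_lt (show 1 < 2 * k by omega), if_neg (by omega)]
    have hx := Nat.mod_lt i (show 2 * k > 0 by omega)
    have hy := Nat.mod_lt j (show 2 * k > 0 by omega)
    simp only [hsucc]
    generalize i % (2 * k) = x at *
    generalize j % (2 * k) = y at *
    by_cases h1 : x + 1 = 2 * k <;> by_cases h2 : y + 1 = 2 * k <;> simp only [h1, h2, if_true,
      if_false, zero_add]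
    · exact not_arcsCross_self _ _
    · exact (hw (y + 1) (by rw [Nat.even_iff]; omega) (by omega) (by omega)).2
    · exact (hw (x + 1) (by rw [Nat.even_iff]; omega) (by omega) (by omega)).1
    · rcases Nat.mod_two_eq_zero_or_one x with h | h
      · exact hu _ _ (by rw [Nat.odd_iff]; omega) (by omega) (by rw [Nat.odd_iff]; omega) (by omega)
      · exact hl _ _ (by rw [Nat.even_iff]; omega) (by omega) (by omega)
          (by rw [Nat.even_iff]; omega) (by omega) (by omega)

theorem IsClosedMeandricPerm.isCyclicMeander {k : ℕ} {b : ℕ → ℕ} (h : IsClosedMeandricPerm k b) :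
    IsCyclicMeander k (fun i => b (i % (2 * k) + 1)) := by
  obtain ⟨hk, -, hr, hi, hp, hu, hl, hw⟩ := h
  exact isCyclicMeander_mod hk hr hi hp hu hl hw

/-- A cyclic meander started at the leftmost crossing is a closed meandric permutation. -/
theorem IsCyclicMeander.isClosedMeandricPerm {k : ℕ} {B c : ℕ → ℕ} (hB : IsCyclicMeander k B)
    (h0 : B 0 = 1) (hc : ∀ i < 2 * k, c (i + 1) = B i) : IsClosedMeandricPerm k c := by
  have hk := hB.pos
  have hc' : ∀ i, 1 ≤ i → i ≤ 2 * k → c i = B (i - 1) := by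
    intro i h1 h2
    rw [← hc _ (by omega), Nat.sub_add_cancel h1]
  have hend : c 1 = B (2 * k - 1 + 1) := by
    rw [hc 0 (by omega), Nat.sub_add_cancel (by omega), ← hB.periodic 0, zero_add]
  have harc : ∀ i, 1 ≤ i → i < 2 * k → c i = B (i - 1) ∧ c (i + 1) = B (i - 1 + 1) :=
    fun i h1 h2 => ⟨hc' i h1 h2.le, by rw [hc i h2, Nat.sub_add_cancel h1]⟩
  refine ⟨hk, by rw [hc 0 (by omega), h0], ?_, ?_, ?_, ?_, ?_, ?_⟩
  · intro i h1 h2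
    rw [hc' i h1 h2]
    exact hB.mem_range _
  · intro i j h1 h2 h3 h4 h
    rw [hc' i h1 h2, hc' j h3 h4] at h
    have := Nat.ModEq.eq_of_lt_of_lt (hB.inj _ _ h) (by omega) (by omega)
    omega
  · intro i h1 h2
    rw [hc' i h1 h2, hB.parity, Nat.sub_add_cancel h1]
  · intro i j h1 h2 h3 h4
    rw [Nat.odd_iff] at h1 h3
    rw [(harc i (by omega) h2).1, (harc i (by omega) h2).2, (harc j (by omega) h4).1,
      (harc j (by omega) h4).2]
    exact hB.noncrossing _ _ (by omega)
  · intro i j h1 h2 h3 h4 h5 h6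
    rw [Nat.even_iff] at h1 h4
    rw [(harc i h2 h3).1, (harc i h2 h3).2, (harc j h5 h6).1, (harc j h5 h6).2]
    exact hB.noncrossing _ _ (by omega)
  · intro i h1 h2 h3
    rw [Nat.even_iff] at h1
    rw [(harc i h2 h3).1, (harc i h2 h3).2, hc' (2 * k) (by omega) le_rfl, hend]
    exact ⟨hB.noncrossing _ _ (by omega), hB.noncrossing _ _ (by omega)⟩

/-- Removing the rightmost crossing from a cyclic meander yields an open meandric permutation. -/
theorem IsCyclicMeander.isOpenMeandricPerm {k : ℕ} {B c : ℕ → ℕ} (hB : IsCyclicMeander k B)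
    (h0 : B (2 * k - 1) = 2 * k) (hc : ∀ i < 2 * k - 1, c (i + 1) = B i) :
    IsOpenMeandricPerm (2 * k - 1) c := by
  have hk := hB.pos
  have hc' : ∀ i, 1 ≤ i → i ≤ 2 * k - 1 → c i = B (i - 1) := by
    intro i h1 h2
    rw [← hc _ (by omega), Nat.sub_add_cancel h1]
  have hlt : ∀ i < 2 * k - 1, B i < 2 * k := by
    intro i hi
    refine lt_of_le_of_ne (hB.mem_range i).2 fun h => ?_
    have := Nat.ModEq.eq_of_lt_of_lt (hB.inj i (2 * k - 1) (h.trans h0.symm)) (by omega) (by omega)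
    omega
  have harc : ∀ i, 1 ≤ i → i < 2 * k - 1 → c i = B (i - 1) ∧ c (i + 1) = B (i - 1 + 1) :=
    fun i h1 h2 => ⟨hc' i h1 h2.le, by rw [hc i h2, Nat.sub_add_cancel h1]⟩
  refine ⟨by omega, ?_, ?_, ?_, ?_, ?_, ?_, ?_⟩
  · intro i h1 h2
    rw [hc' i h1 h2]
    have := hlt (i - 1) (by omega)
    exact ⟨(hB.mem_range _).1, by omega⟩
  · intro i j h1 h2 h3 h4 h
    rw [hc' i h1 h2, hc' j h3 h4] at h
    have := Nat.ModEq.eq_of_lt_of_lt (hB.inj _ _ h) (by omega) (by omega)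
    omega
  · intro i h1 h2
    rw [hc' i h1 h2, hB.parity, Nat.sub_add_cancel h1]
  · intro i j h1 h2 h3 h4
    rw [Nat.odd_iff] at h1 h3
    rw [(harc i (by omega) h2).1, (harc i (by omega) h2).2, (harc j (by omega) h4).1,
      (harc j (by omega) h4).2]
    exact hB.noncrossing _ _ (by omega)
  · intro i j h1 h2 h3 h4 h5 h6
    rw [Nat.even_iff] at h1 h4
    rw [(harc i h2 h3).1, (harc i h2 h3).2, (harc j h5 h6).1, (harc j h5 h6).2]
    exact hB.noncrossing _ _ (by omega)
  · intro i h1 h2 h3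
    rw [Nat.even_iff] at h1
    rw [(harc i h2 h3).1, (harc i h2 h3).2, hc 0 (by omega)]
    have h := hB.noncrossing (2 * k - 1) (i - 1) (by omega)
    have hend : B (2 * k - 1 + 1) = B 0 := by
      rw [Nat.sub_add_cancel (by omega), ← hB.periodic 0, zero_add]
    have h4 := hlt (i - 1) (by omega)
    have h5 := hlt (i - 1 + 1) (by omega)
    rw [h0, hend] at h
    simp only [arcsCross_iff, StrictlyBetween] at h ⊢
    omega
  · rw [if_neg (by rw [Nat.even_iff]; omega)]
    intro i h1 h3
    rw [Nat.odd_iff] at h1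
    rw [(harc i (by omega) h3).1, (harc i (by omega) h3).2, hc' (2 * k - 1) (by omega) le_rfl]
    have h := hB.noncrossing (2 * k - 2) (i - 1) (by omega)
    have h4 := hlt (i - 1) (by omega)
    have h5 := hlt (i - 1 + 1) (by omega)
    rw [show 2 * k - 2 + 1 = 2 * k - 1 by omega, h0] at h
    rw [show 2 * k - 1 - 1 = 2 * k - 2 by omega]
    simp only [arcsCross_iff, StrictlyBetween] at h ⊢
    omega

/-- An open meander with an even number of crossings closes up in the lower half plane. -/
theorem IsOpenMeandricPerm.isCyclicMeander_even {k : ℕ} {a : ℕ → ℕ}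
    (h : IsOpenMeandricPerm (2 * k) a) : IsCyclicMeander k (fun i => a (i % (2 * k) + 1)) := by
  obtain ⟨hk, hr, hi, hp, hu, hl, h1, h2⟩ := h
  rw [if_pos (by simp)] at h2
  refine isCyclicMeander_mod (by omega) hr hi hp hu hl fun i he hi1 hi2 => ?_
  rw [Nat.even_iff] at he
  have e1 : a i ≠ a 1 := fun e => by
    have := hi _ _ (by omega) (by omega) (by omega) (by omega) e; omega
  have e2 : a i ≠ a (2 * k) := fun e => by
    have := hi _ _ (by omega) (by omega) (by omega) (by omega) e; omega
  have e3 : a (i + 1) ≠ a 1 := fun e => by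
    have := hi _ _ (by omega) (by omega) (by omega) (by omega) e; omega
  have e4 : a (i + 1) ≠ a (2 * k) := fun e => by
    have := hi _ _ (by omega) (by omega) (by omega) (by omega) e; omega
  have h1 := h1 i (Nat.even_iff.2 he) hi1 hi2
  have h2 := h2 i (Nat.even_iff.2 he) hi1 hi2
  simp only [arcsCross_iff, StrictlyBetween] at h1 h2 ⊢
  omega

/-- An open meander with an odd number of crossings closes up through one additional crossing
at the far right. -/
theorem IsOpenMeandricPerm.isCyclicMeander_odd {k : ℕ} {a : ℕ → ℕ}
    (h : IsOpenMeandricPerm (2 * k - 1) a) :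
    IsCyclicMeander k (fun i => Function.update a (2 * k) (2 * k) (i % (2 * k) + 1)) := by
  obtain ⟨hk, hr, hi, hp, hu, hl, h1, h2⟩ := h
  rw [if_neg (by rw [Nat.even_iff]; omega)] at h2
  have hlast : Function.update a (2 * k) (2 * k) (2 * k) = 2 * k := by simp
  have hold : ∀ i, i < 2 * k → Function.update a (2 * k) (2 * k) i = a i := fun i h =>
    Function.update_of_ne h.ne _ _
  generalize Function.update a (2 * k) (2 * k) = b at hlast hold
  have hcross : ∀ i, i % 2 = 1 → i < 2 * k - 1 →
      ¬ ArcsCross (b i) (b (i + 1)) (b (2 * k - 1)) (b (2 * k)) ∧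
      ¬ ArcsCross (b (2 * k - 1)) (b (2 * k)) (b i) (b (i + 1)) := by
    intro i ho h
    rw [hold i (by omega), hold (i + 1) (by omega), hold _ (by omega), hlast]
    have h3 := h2 i (Nat.odd_iff.2 ho) h
    have h4 := hr i (by omega) (by omega)
    have h5 := hr (i + 1) (by omega) (by omega)
    have e1 : a i ≠ a (2 * k - 1) := fun e => by
      have := hi _ _ (by omega) (by omega) (by omega) (by omega) e; omega
    have e2 : a (i + 1) ≠ a (2 * k - 1) := fun e => by
      have := hi _ _ (by omega) (by omega) (by omega) (by omega) e; omega
    simp only [arcsCross_iff, StrictlyBetween] at h3 ⊢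
    omega
  refine isCyclicMeander_mod (by omega) ?_ ?_ ?_ ?_ ?_ ?_
  · intro i hi1 hi2
    rcases hi2.eq_or_lt with rfl | hlt
    · omega
    · rw [hold i hlt]
      have := hr i hi1 (by omega)
      omega
  · intro i j hi1 hi2 hj1 hj2 e
    rcases hi2.eq_or_lt with rfl | hlt <;> rcases hj2.eq_or_lt with rfl | hlt'
    · rfl
    · rw [hlast, hold j hlt'] at e
      have := hr j hj1 (by omega)
      omega
    · rw [hlast, hold i hlt] at e
      have := hr i hi1 (by omega)
      omega
    · rw [hold i hlt, hold j hlt'] at e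
      exact hi i j hi1 (by omega) hj1 (by omega) e
  · intro i hi1 hi2
    rcases hi2.eq_or_lt with rfl | hlt
    · rw [hlast]
    · rw [hold i hlt]
      exact hp i hi1 (by omega)
  · intro i j ho hi2 ho' hj2
    rw [Nat.odd_iff] at ho ho'
    by_cases e : i = 2 * k - 1
    · by_cases e' : j = 2 * k - 1
      · rw [e, e']
        exact not_arcsCross_self _ _
      · rw [e, Nat.sub_add_cancel (by omega)]
        exact (hcross j ho' (by omega)).2
    · by_cases e' : j = 2 * k - 1
      · rw [e', Nat.sub_add_cancel (by omega)]
        exact (hcross i ho (by omega)).1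
      · rw [hold i hi2, hold j hj2, hold (i + 1) (by omega), hold (j + 1) (by omega)]
        exact hu i j (Nat.odd_iff.2 ho) (by omega) (Nat.odd_iff.2 ho') (by omega)
  · intro i j he hi1 hi2 he' hj1 hj2
    have := Nat.even_iff.1 he
    have := Nat.even_iff.1 he'
    rw [hold i hi2, hold j hj2, hold (i + 1) (by omega), hold (j + 1) (by omega)]
    exact hl i j he hi1 (by omega) he' hj1 (by omega)
  · intro i he hi1 hi2
    have he' := Nat.even_iff.1 he
    rw [hold i hi2, hold (i + 1) (by omega), hold 1 (by omega), hlast]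
    have h3 := h1 i he hi1 (by omega)
    have h4 := hr i (by omega) (by omega)
    have h5 := hr (i + 1) (by omega) (by omega)
    have e1 : a i ≠ a 1 := fun e => by
      have := hi _ _ (by omega) (by omega) (by omega) (by omega) e; omega
    have e2 : a (i + 1) ≠ a 1 := fun e => by
      have := hi _ _ (by omega) (by omega) (by omega) (by omega) e; omega
    simp only [arcsCross_iff, StrictlyBetween] at h3 ⊢
    omega

/-! ### Comparing the counts -/

/-- Functions on `ℕ` with values at most `N` that vanish beyond `N` form a finite set. -/
theorem finite_setOf_le_of_support_le (N : ℕ) :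
    {a : ℕ → ℕ | (∀ i, a i ≤ N) ∧ ∀ i, N < i → a i = 0}.Finite := by
  refine (Set.finite_range (fun (f : Fin (N + 1) → Fin (N + 1)) (i : ℕ) =>
    if h : i < N + 1 then (f ⟨i, h⟩ : ℕ) else 0)).subset ?_
  rintro a ⟨h1, h2⟩
  refine ⟨fun i => ⟨a i, Nat.lt_succ_of_le (h1 i)⟩, funext fun i => ?_⟩
  by_cases h : i < N + 1
  · simp [h]
  · simp [h, h2 i (by omega)]

theorem finite_openMeanders (n : ℕ) :
    {a : ℕ → ℕ | IsOpenMeandricPerm n a ∧ ∀ i, i < 1 ∨ n < i → a i = 0}.Finite := by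
  refine (finite_setOf_le_of_support_le n).subset ?_
  rintro a ⟨⟨-, hr, -⟩, h0⟩
  refine ⟨fun i => ?_, fun i hi => h0 i (Or.inr hi)⟩
  by_cases h : i < 1 ∨ n < i
  · simp [h0 i h]
  · exact (hr i (by omega) (by omega)).2

theorem finite_closedMeanders (n : ℕ) :
    {a : ℕ → ℕ | IsClosedMeandricPerm n a ∧ ∀ i, i < 1 ∨ 2 * n < i → a i = 0}.Finite := by
  refine (finite_setOf_le_of_support_le (2 * n)).subset ?_
  rintro a ⟨⟨-, -, hr, -⟩, h0⟩
  refine ⟨fun i => ?_, fun i hi => h0 i (Or.inr hi)⟩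
  by_cases h : i < 1 ∨ 2 * n < i
  · simp [h0 i h]
  · exact (hr i (by omega) (by omega)).2

/-- The first `n` terms, started at time `s`, of the periodic sequence whose period is
`c 1, …, c m`, with zeros replaced by `m`. -/
def rotatedWord (m n s : ℕ) (c : ℕ → ℕ) (i : ℕ) : ℕ :=
  if 1 ≤ i ∧ i ≤ n then
    if c ((i - 1 + s) % m + 1) = 0 then m else c ((i - 1 + s) % m + 1)
  else 0

theorem ncard_le_of_forall_eq_rotatedWord {S T : Set (ℕ → ℕ)} (m n : ℕ) (hT : T.Finite)
    (h : ∀ a ∈ S, ∃ s ≤ m, ∃ c ∈ T, a = rotatedWord m n s c) :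
    S.ncard ≤ (m + 1) * T.ncard := by
  have hfin : (Set.Iic m ×ˢ T).Finite := (Set.finite_Iic m).prod hT
  have hsub : S ⊆ (fun x : ℕ × (ℕ → ℕ) => rotatedWord m n x.1 x.2) '' (Set.Iic m ×ˢ T) := by
    intro a ha
    obtain ⟨s, hs, c, hc, rfl⟩ := h a ha
    exact ⟨(s, c), ⟨hs, hc⟩, rfl⟩
  calc S.ncard ≤ _ := Set.ncard_le_ncard hsub (hfin.image _)
    _ ≤ (Set.Iic m ×ˢ T).ncard := Set.ncard_image_le hfin
    _ = (m + 1) * T.ncard := by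
      rw [Set.ncard_prod, ← Finset.coe_Iic, Set.ncard_coe_finset, Nat.card_Iic]

/-- A cyclic meander is recovered by rotating back any of its rotations. -/
theorem IsCyclicMeander.eq_rotatedWord {k n p : ℕ} {B a c : ℕ → ℕ} (hB : IsCyclicMeander k B)
    (hp : p ≤ 2 * k) (ha : ∀ i, 1 ≤ i → i ≤ n → a i = B (i - 1))
    (ha0 : ∀ i, i < 1 ∨ n < i → a i = 0)
    (hc : ∀ i < 2 * k, (if c (i + 1) = 0 then 2 * k else c (i + 1)) = B (i + p)) :
    a = rotatedWord (2 * k) n (2 * k - p) c := by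
  have hk := hB.pos
  funext i
  unfold rotatedWord
  split_ifs with h h'
  all_goals try exact ha0 i (by omega)
  all_goals
    have hm := hc _ (Nat.mod_lt (i - 1 + (2 * k - p)) (by omega : 2 * k > 0))
    have hper : Function.Periodic (fun i => B (i + p)) (2 * k) := fun i => by
      simp only [add_right_comm i, hB.periodic (i + p)]
    have hs := hper.map_mod_nat (i - 1 + (2 * k - p))
    have hback : B (i - 1 + (2 * k - p) + p) = B (i - 1) := by
      rw [show i - 1 + (2 * k - p) + p = i - 1 + 2 * k by omega, hB.periodic]
    simp only [h', if_true, if_false] at hm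
    rw [ha i h.1 h.2, hm, ← hback]
    exact hs.symm

theorem openMeanderCount_le (n : ℕ) :
    openMeanderCount n ≤ (n + 2) * closedMeanderCount ((n + 1) / 2) := by
  obtain ⟨k, hk⟩ : ∃ k, k = (n + 1) / 2 := ⟨_, rfl⟩
  rw [← hk]
  refine (ncard_le_of_forall_eq_rotatedWord (2 * k) n (finite_closedMeanders k) ?_).trans
    (Nat.mul_le_mul_right _ (by omega))
  rintro a ⟨ha, ha0⟩
  obtain ⟨B, hB, haB⟩ : ∃ B, IsCyclicMeander k B ∧ ∀ i, 1 ≤ i → i ≤ n → a i = B (i - 1) := by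
    rcases Nat.even_or_odd n with he | ho
    · obtain rfl : n = 2 * k := by have := Nat.even_iff.1 he; omega
      refine ⟨_, ha.isCyclicMeander_even, fun i h1 h2 => ?_⟩
      rw [Nat.mod_eq_of_lt (by omega), Nat.sub_add_cancel h1]
    · obtain rfl : n = 2 * k - 1 := by have := Nat.odd_iff.1 ho; omega
      refine ⟨_, ha.isCyclicMeander_odd, fun i h1 h2 => ?_⟩
      rw [Nat.mod_eq_of_lt (by omega), Nat.sub_add_cancel h1,
        Function.update_of_ne (by omega)]
  have hk := hB.pos
  obtain ⟨p, hp, hp1⟩ := hB.exists_eq le_rfl (show 1 ≤ 2 * k by omega)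
  have hpar : p % 2 = 0 := by have := hB.parity p; omega
  have hc : ∀ i < 2 * k, (fun j => if 1 ≤ j ∧ j ≤ 2 * k then B (j - 1 + p) else 0) (i + 1)
      = B (i + p) := by
    intro i hi
    simp [show i + 1 ≤ 2 * k by omega]
  refine ⟨2 * k - p, by omega, fun j => if 1 ≤ j ∧ j ≤ 2 * k then B (j - 1 + p) else 0,
    ⟨(hB.shift hpar).isClosedMeandricPerm (by simpa using hp1) hc, ?_⟩,
    hB.eq_rotatedWord hp.le haB ha0 ?_⟩
  · intro i hi
    exact if_neg (by omega)
  · intro i hi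
    beta_reduce at hc ⊢
    rw [hc i hi, if_neg]
    have := hB.mem_range (i + p)
    omega

theorem closedMeanderCount_le (k : ℕ) :
    closedMeanderCount k ≤ (2 * k + 1) * openMeanderCount (2 * k - 1) := by
  refine ncard_le_of_forall_eq_rotatedWord (2 * k) (2 * k) (finite_openMeanders (2 * k - 1)) ?_
  rintro a ⟨ha, ha0⟩
  have hB := ha.isCyclicMeander
  have haB : ∀ i, 1 ≤ i → i ≤ 2 * k → a i = a ((i - 1) % (2 * k) + 1) := by
    intro i h1 h2
    rw [Nat.mod_eq_of_lt (by omega), Nat.sub_add_cancel h1]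
  generalize hBdef : (fun i => a (i % (2 * k) + 1)) = B at hB
  have haB' : ∀ i, 1 ≤ i → i ≤ 2 * k → a i = B (i - 1) := by
    intro i h1 h2
    rw [← hBdef]
    exact haB i h1 h2
  have hk := hB.pos
  obtain ⟨q, hq, hq1⟩ := hB.exists_eq (show 1 ≤ 2 * k by omega) le_rfl
  have hpar : (q + 1) % 2 = 0 := by have := hB.parity q; omega
  have hlast : B (2 * k - 1 + (q + 1)) = 2 * k := by
    rw [show 2 * k - 1 + (q + 1) = q + 2 * k by omega, hB.periodic, hq1]
  have hc : ∀ i < 2 * k - 1,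
      (fun j => if 1 ≤ j ∧ j ≤ 2 * k - 1 then B (j - 1 + (q + 1)) else 0) (i + 1)
        = B (i + (q + 1)) := by
    intro i hi
    simp [show i + 1 ≤ 2 * k - 1 by omega]
  refine ⟨2 * k - (q + 1), by omega,
    fun j => if 1 ≤ j ∧ j ≤ 2 * k - 1 then B (j - 1 + (q + 1)) else 0,
    ⟨(hB.shift hpar).isOpenMeandricPerm hlast hc, ?_⟩,
    hB.eq_rotatedWord (by omega) haB' ha0 ?_⟩
  · intro i hi
    exact if_neg (by omega)
  · intro i hi
    by_cases h : i < 2 * k - 1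
    · beta_reduce at hc ⊢
      rw [hc i h, if_neg]
      have := hB.mem_range (i + (q + 1))
      omega
    · obtain rfl : i = 2 * k - 1 := by omega
      rw [hlast, if_pos]
      exact if_neg (by omega)

/-! ### Growth rates -/

theorem rpow_one_div_le_iff_le_pow {x c : ℝ} (hx : 0 ≤ x) (hc : 0 ≤ c) {n : ℕ} (hn : 1 ≤ n) :
    x ^ (1 / (n : ℝ)) ≤ c ↔ x ≤ c ^ n := by
  rw [one_div, Real.rpow_inv_le_iff_of_pos hx hc (by exact_mod_cast hn), Real.rpow_natCast]

/-- If `v k` is at most `(2 k + 1) u (2 k - 1)` then exponential boundedness passes from `u`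
to `v`. -/
theorem isBoundedUnder_rpow_of_le {u v : ℕ → ℕ} (hv : ∀ k, v k ≤ (2 * k + 1) * u (2 * k - 1))
    (hu : IsBoundedUnder (· ≤ ·) atTop (fun n : ℕ => (u n : ℝ) ^ (1 / (n : ℝ)))) :
    IsBoundedUnder (· ≤ ·) atTop (fun n : ℕ => (v n : ℝ) ^ (1 / (n : ℝ))) := by
  obtain ⟨C, hC⟩ := hu
  rw [eventually_map, eventually_atTop] at hC
  obtain ⟨N, hN⟩ := hC
  set D := max C 1
  have hD : 1 ≤ D := le_max_right _ _
  refine ⟨3 * D ^ 2, ?_⟩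
  rw [eventually_map, eventually_atTop]
  refine ⟨N + 1, fun k hk => ?_⟩
  beta_reduce
  rw [rpow_one_div_le_iff_le_pow (by positivity) (by positivity) (by omega)]
  have h1 : (u (2 * k - 1) : ℝ) ≤ D ^ (2 * k - 1) :=
    (rpow_one_div_le_iff_le_pow (by positivity) (by positivity) (by omega)).1
      ((hN _ (by omega)).trans (le_max_left _ _))
  have h2 : D ^ (2 * k - 1) ≤ D ^ (2 * k) := pow_le_pow_right₀ hD (by omega)
  have h3 : (2 * k + 1 : ℝ) ≤ 3 ^ k := by
    have := one_add_mul_le_pow (show (-2 : ℝ) ≤ 2 by norm_num) k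
    norm_num at this
    linarith
  calc (v k : ℝ) ≤ (2 * k + 1) * u (2 * k - 1) := by exact_mod_cast hv k
    _ ≤ 3 ^ k * D ^ (2 * k) := by gcongr; exact h1.trans h2
    _ = (3 * D ^ 2) ^ k := by rw [mul_pow, pow_mul]

theorem limsup_rpow_le_sqrt {u v : ℕ → ℕ} (hu : ∀ n, u n ≤ (n + 2) * v ((n + 1) / 2))
    (hv : ∀ k, v k ≤ (2 * k + 1) * u (2 * k - 1)) {L : ℝ}
    (h : limsup (fun n : ℕ => (v n : ℝ) ^ (1 / (n : ℝ))) atTop ≤ L) :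
    limsup (fun n : ℕ => (u n : ℝ) ^ (1 / (n : ℝ))) atTop ≤ √L := by
  by_cases hb : IsBoundedUnder (· ≤ ·) atTop (fun n : ℕ => (u n : ℝ) ^ (1 / (n : ℝ)))
  swap
  · have hempty : {a : ℝ | ∀ᶠ n : ℕ in atTop, (u n : ℝ) ^ (1 / (n : ℝ)) ≤ a} = ∅ :=
      Set.eq_empty_of_forall_notMem fun a ha => hb ⟨a, by simpa using ha⟩
    rw [limsup_eq, hempty, Real.sInf_empty]
    exact Real.sqrt_nonneg _
  have hbv := isBoundedUnder_rpow_of_le hv hb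
  refine le_of_forall_gt_imp_ge_of_dense fun c hc => ?_
  obtain ⟨r, hr, hrc⟩ := exists_between hc
  have hr0 : 0 < r := (Real.sqrt_nonneg _).trans_lt hr
  have hc0 : 0 < c := hr0.trans hrc
  have hLr : L < r ^ 2 := (Real.sqrt_lt' hr0).1 hr
  have hev := eventually_lt_of_limsup_lt (h.trans_lt hLr) hbv
  rw [eventually_atTop] at hev
  obtain ⟨N, hN⟩ := hev
  have hlim : Tendsto (fun n : ℕ => (1 + r) * ((n : ℝ) * (r / c) ^ n + 2 * (r / c) ^ n)) atTop
      (nhds ((1 + r) * (0 + 2 * 0))) := by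
    have h0 : 0 ≤ r / c := by positivity
    have h1 : r / c < 1 := (div_lt_one hc0).2 hrc
    exact ((tendsto_self_mul_const_pow_of_lt_one h0 h1).add
      ((tendsto_pow_atTop_nhds_zero_of_lt_one h0 h1).const_mul 2)).const_mul _
  have hsmall := hlim.eventually_le_const (show (1 + r) * (0 + 2 * 0) < 1 by norm_num)
  refine limsup_le_of_le (isCoboundedUnder_le_of_le atTop (x := 0) fun n => by positivity) ?_
  filter_upwards [hsmall, eventually_ge_atTop (2 * N + 1)] with n hn hnN
  rw [rpow_one_div_le_iff_le_pow (by positivity) hc0.le (by omega)]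
  have h1 : (v ((n + 1) / 2) : ℝ) ≤ (r ^ 2) ^ ((n + 1) / 2) :=
    (rpow_one_div_le_iff_le_pow (by positivity) (by positivity) (by omega)).1
      (hN _ (by omega)).le
  have h2 : (r ^ 2) ^ ((n + 1) / 2) ≤ (1 + r) * r ^ n := by
    have hpos : 0 < r ^ n := by positivity
    rw [← pow_mul]
    rcases Nat.mod_two_eq_zero_or_one n with he | ho
    · rw [show 2 * ((n + 1) / 2) = n by omega]
      nlinarith
    · rw [show 2 * ((n + 1) / 2) = n + 1 by omega, pow_succ]
      nlinarith
  calc (u n : ℝ) ≤ (n + 2) * v ((n + 1) / 2) := by exact_mod_cast hu n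
    _ ≤ (n + 2) * ((1 + r) * r ^ n) := by gcongr; exact h1.trans h2
    _ = (1 + r) * ((n : ℝ) * (r / c) ^ n + 2 * (r / c) ^ n) * c ^ n := by
      rw [div_pow]
      field_simp
    _ ≤ 1 * c ^ n := by gcongr
    _ = c ^ n := one_mul _

/-- If `limsup (M̄ n)^(1/n) ≤ 12.901`, then `limsup (M n)^(1/n) ≤ √12.901`. -/
theorem openMeander_growth_le_sqrt_closed (h :
    limsup (fun n : ℕ => (closedMeanderCount n : ℝ) ^ (1 / (n : ℝ))) atTop ≤ 12.901) :
    limsup (fun n : ℕ => (openMeanderCount n : ℝ) ^ (1 / (n : ℝ))) atTop ≤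
      Real.sqrt 12.901 := by
  exact limsup_rpow_le_sqrt openMeanderCount_le closedMeanderCount_le h
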